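/- Let P be a type of joint plans, let 𝒮 ⊆ P be the set of solutions, and for any set C of constraints (predicates on P) define Sat(C) = {Π ∈ 𝒮 | ∀ c ∈ C, c Π}. For all constraint sets C1 and C2, the following are equivalent: (i) for every constraint set N_C, Sat(N_C) = Sat(N_C ∪ C1) ∪ Sat(N_C ∪ C2); (ii) for every c1 ∈ C1, every c2 ∈ C2, and every Π ∈ 𝒮, c1 Π ∨ c2 Π holds. (This is the paper's Lemma: a branching rule that adds C1 to one child and C2 to the other preserves the solution set at every node if and only if the constraint set pair ⟨C1, C2⟩ is sound.) -/

import Mathlib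

/-- A branching rule that adds `C1` to one child and `C2` to the other preserves
the solution set at every node iff the constraint set pair `⟨C1, C2⟩` is sound. -/
theorem sound_branching_iff_sound_constraint_sets {P : Type*} (S : Set P)
    (C1 C2 : Set (P → Prop)) :
    (∀ NC : Set (P → Prop),
        {JP | JP ∈ S ∧ ∀ c ∈ NC, c JP} =
          {JP | JP ∈ S ∧ ∀ c ∈ NC ∪ C1, c JP} ∪
            {JP | JP ∈ S ∧ ∀ c ∈ NC ∪ C2, c JP}) ↔
      (∀ c1 ∈ C1, ∀ c2 ∈ C2, ∀ JP ∈ S, c1 JP ∨ c2 JP) := by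
  constructor
  · intro h c1 h1 c2 h2 JP hJP
    have hmem : JP ∈ {JP | JP ∈ S ∧ ∀ c ∈ (∅ : Set (P → Prop)), c JP} :=
      ⟨hJP, fun _ hc => hc.elim⟩
    rw [h ∅] at hmem
    exact hmem.imp (fun hl => hl.2 c1 (Or.inr h1)) (fun hr => hr.2 c2 (Or.inr h2))
  · intro h NC
    ext JP
    constructor
    · rintro ⟨hJP, hNC⟩
      by_cases hC1 : ∀ c ∈ C1, c JP
      · exact Or.inl ⟨hJP, fun c hc => hc.elim (hNC c) (hC1 c)⟩
      · push Not at hC1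
        obtain ⟨c1, h1, hn⟩ := hC1
        exact Or.inr ⟨hJP, fun c hc =>
          hc.elim (hNC c) fun h2 => (h c1 h1 c h2 JP hJP).resolve_left hn⟩
    · rintro (⟨hJP, hc⟩ | ⟨hJP, hc⟩) <;> exact ⟨hJP, fun c h' => hc c (Or.inl h')⟩
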